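/- For every natural number k there exists a finite simple graph G that is nice and satisfies χ_p(G) > k. That is, nice graphs have unbounded perfect chromatic number. -/

import Mathlib

open SimpleGraph

/-- The chromatic number of a graph, as a natural number. -/
noncomputable def chi {V : Type*} (G : SimpleGraph V) : ℕ :=
  sInf {n | G.Colorable n}

/-- The independence (stability) number of a graph. -/
noncomputable def indepNum {V : Type*} (G : SimpleGraph V) : ℕ :=
  sSup {n | ∃ s : Finset V, s.card = n ∧ ∀ a ∈ s, ∀ b ∈ s, ¬ G.Adj a b}

/-- A graph is perfect if every induced subgraph has chromatic number equal to
its clique number. -/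
def IsPerfect {V : Type*} (G : SimpleGraph V) : Prop :=
  ∀ s : Set V, chi (G.induce s) = (G.induce s).cliqueNum

/-- A graph is nice if every induced subgraph `H` satisfies `χ(H) - ω(H) ∈ {0, 1}`. -/
def IsNice {V : Type*} (G : SimpleGraph V) : Prop :=
  ∀ s : Set V, chi (G.induce s) = (G.induce s).cliqueNum ∨
    chi (G.induce s) = (G.induce s).cliqueNum + 1

/-- The perfect chromatic number: the smallest `k` such that the vertex set can be
partitioned into `k` perfect sets. -/
noncomputable def chiP {V : Type*} (G : SimpleGraph V) : ℕ :=
  sInf {k | ∃ f : V → Fin k, ∀ i, IsPerfect (G.induce (f ⁻¹' {i}))}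

open Function in
/-- The orbit, under two involutions `a` and `b`, of a fixed point `x` of `b` contains at most one
fixed point of `b` other than `x`. -/
lemma exists_orbit_of_involutive {V : Type*} {a b : V → V} (ha : Involutive a)
    (hb : Involutive b) {x : V} (hx : b x = x) :
    ∃ C : Set V, x ∈ C ∧ (∀ y ∈ C, a y ∈ C) ∧ (∀ y ∈ C, b y ∈ C) ∧
      ∀ y ∈ C, ∀ z ∈ C, b y = y → b z = z → y ≠ x → z ≠ x → y = z := by
  set σ : Equiv.Perm V := ha.toPerm * hb.toPerm with hσ
  have hσa : ∀ y, σ y = a (b y) := fun y => rfl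
  have hσi : ∀ y, σ⁻¹ y = b (a y) := fun y => by
    rw [Equiv.Perm.inv_eq_iff_eq, hσa, hb, ha]
  have hbσ : ∀ y, b (σ y) = σ⁻¹ (b y) := fun y => by rw [hσa, hσi]
  have hbσ' : ∀ y, b (σ⁻¹ y) = σ (b y) := fun y => by rw [hσa, hσi, hb, hb]
  have hb_zpow : ∀ n : ℤ, b ((σ ^ n) x) = (σ ^ (-n)) x := by
    intro n
    induction n using Int.induction_on with
    | zero => simpa using hx
    | succ n ih =>
      rw [add_comm, zpow_add, Equiv.Perm.mul_apply, zpow_one, hbσ, ih, ← Equiv.Perm.mul_apply,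
        ← zpow_neg_one, ← zpow_add]
      congr 2; ring
    | pred n ih =>
      rw [sub_eq_add_neg, add_comm, zpow_add, Equiv.Perm.mul_apply, zpow_neg_one, hbσ', ih,
        ← Equiv.Perm.mul_apply, ← zpow_one_add]
      congr 2; ring
  have hfix : ∀ n : ℤ, b ((σ ^ n) x) = (σ ^ n) x → (minimalPeriod (σ • ·) x : ℤ) ∣ 2 * n := by
    intro n hn
    rw [← MulAction.zpow_smul_eq_iff_minimalPeriod_dvd, Equiv.Perm.smul_def, two_mul, zpow_add,
      Equiv.Perm.mul_apply, ← hn, hb_zpow, ← Equiv.Perm.mul_apply, ← zpow_add]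
    simp
  have hne : ∀ n : ℤ, (σ ^ n) x ≠ x → ¬ (minimalPeriod (σ • ·) x : ℤ) ∣ n := by
    intro n hn hdvd
    exact hn (MulAction.zpow_smul_eq_iff_minimalPeriod_dvd.2 hdvd)
  refine ⟨{y | ∃ n : ℤ, (σ ^ n) x = y}, ⟨0, rfl⟩, ?_, ?_, ?_⟩
  · rintro _ ⟨n, rfl⟩
    refine ⟨1 + -n, ?_⟩
    rw [zpow_add, Equiv.Perm.mul_apply, ← hb_zpow, zpow_one, hσa, hb]
  · rintro _ ⟨n, rfl⟩
    exact ⟨-n, (hb_zpow n).symm⟩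
  · rintro _ ⟨n, rfl⟩ _ ⟨l, rfl⟩ hn hl hn' hl'
    obtain ⟨s, hs⟩ := hfix n hn
    obtain ⟨t, ht⟩ := hfix l hl
    have hs' := hne n hn'
    have ht' := hne l hl'
    set p : ℤ := (minimalPeriod (σ • ·) x : ℤ)
    have hs2 : ¬ Even s := by
      rintro ⟨r, rfl⟩
      exact hs' ⟨r, by linarith [mul_add p r r]⟩
    have ht2 : ¬ Even t := by
      rintro ⟨r, rfl⟩
      exact ht' ⟨r, by linarith [mul_add p r r]⟩
    rw [Int.not_even_iff_odd] at hs2 ht2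
    obtain ⟨r, hr⟩ := hs2.sub_odd ht2
    have hdvd : p ∣ -l + n := ⟨r, by
      have := congrArg (p * ·) hr
      simp only [mul_sub, mul_add] at this
      linarith⟩
    have := MulAction.zpow_smul_eq_iff_minimalPeriod_dvd.2 hdvd
    rw [Equiv.Perm.smul_def, zpow_add, Equiv.Perm.mul_apply, zpow_neg,
      Equiv.Perm.inv_eq_iff_eq] at this
    exact this

open Function Finset Classical in
/-- Colour classes are given as involutions `m l`. If the lists `M w` of colours missing at the
vertices `w ∈ W` have total size odd and less than `2 * #K`, then after recolouring some colour
lies in exactly one list. -/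
lemma exists_recolouring_card_eq_one {V κ : Type*} (K : Finset κ) (W : Finset V)
    (m : κ → V → V) (M : V → Finset κ) (hm : ∀ l, Involutive (m l))
    (hMK : ∀ w ∈ W, M w ⊆ K) (hfix : ∀ w ∈ W, ∀ l ∈ M w, m l w = w)
    (hodd : Odd (∑ w ∈ W, #(M w))) (hlt : ∑ w ∈ W, #(M w) < 2 * #K) :
    ∃ (m' : κ → V → V) (M' : V → Finset κ), (∀ l, Involutive (m' l)) ∧
      (∀ w ∈ W, M' w ⊆ K) ∧ (∀ w ∈ W, ∀ l ∈ M' w, m' l w = w) ∧ (∀ w, #(M' w) = #(M w)) ∧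
      (∀ y z, (∃ l ∈ K, m l y = z) → ∃ l ∈ K, m' l y = z) ∧
      ∃ i ∈ K, #{w ∈ W | i ∈ M' w} = 1 := by
  induction h : ∑ l ∈ K, #{w ∈ W | l ∈ M w} ^ 2 using Nat.strong_induction_on
    generalizing m M with
  | _ s ih =>
  by_cases hone : ∃ i ∈ K, #{w ∈ W | i ∈ M w} = 1
  · exact ⟨m, M, hm, hMK, hfix, fun _ => rfl, fun _ _ h => h, hone⟩
  push Not at hone
  have hcount : ∑ w ∈ W, #(M w) = ∑ l ∈ K, #{w ∈ W | l ∈ M w} := by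
    refine Eq.trans ?_ (sum_card_bipartiteAbove_eq_sum_card_bipartiteBelow (fun w l => l ∈ M w))
    refine sum_congr rfl fun w hw => congrArg card ?_
    ext l
    simpa [bipartiteAbove] using fun hl => hMK w hw hl
  rw [hcount] at hodd hlt
  obtain ⟨i, hiK, hi⟩ : ∃ i ∈ K, #{w ∈ W | i ∈ M w} < 2 := by
    apply exists_lt_of_sum_lt
    simpa [mul_comm] using hlt
  have hi0 : ∀ w ∈ W, i ∉ M w := by
    have : #{w ∈ W | i ∈ M w} = 0 := by have := hone i hiK; omega
    simpa [filter_eq_empty_iff] using this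
  obtain ⟨j, hjK, hj⟩ : ∃ j ∈ K, Odd #{w ∈ W | j ∈ M w} := by
    by_contra! hcon
    exact (Nat.not_even_iff_odd.2 hodd)
      (even_sum _ fun l hl => Nat.not_odd_iff_even.1 (hcon l hl))
  have hj3 : 3 ≤ #{w ∈ W | j ∈ M w} := by
    have := hone j hjK
    obtain ⟨r, hr⟩ := hj
    omega
  obtain ⟨x, hx⟩ : ({w ∈ W | j ∈ M w} : Finset V).Nonempty := card_pos.1 (by omega)
  rw [mem_filter] at hx
  have hij : i ≠ j := by
    rintro rfl
    exact hi0 x hx.1 hx.2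
  obtain ⟨C, hxC, hCi, hCj, hC⟩ := exists_orbit_of_involutive (hm i) (hm j) (hfix x hx.1 j hx.2)
  set τ := Equiv.swap i j with hτ
  have hττ : ∀ l, τ (τ l) = l := fun l => by simp [hτ]
  have hτne : ∀ l, l ≠ i → l ≠ j → τ l = l := fun l => Equiv.swap_apply_of_ne_of_ne
  have hτi : τ i = j := Equiv.swap_apply_left i j
  have hτj : τ j = i := Equiv.swap_apply_right i j
  have hτK : ∀ l ∈ K, τ l ∈ K := fun l hl => by
    by_cases h1 : l = i
    · rwa [h1, hτi]
    by_cases h2 : l = j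
    · rwa [h2, hτj]
    rwa [hτne l h1 h2]
  set m₁ : κ → V → V := fun l y => if y ∈ C then m (τ l) y else m l y with hm₁
  set M₁ : V → Finset κ := fun y => if y ∈ C then (M y).map τ.toEmbedding else M y with hM₁
  have hmem : ∀ l w, l ∈ M₁ w ↔ (w ∈ C ∧ τ l ∈ M w) ∨ (w ∉ C ∧ l ∈ M w) := by
    intro l w
    by_cases hw : w ∈ C
    · simp only [hM₁, hw, if_true, mem_map, true_and, not_true, false_and, or_false]
      constructor
      · rintro ⟨l', hl', rfl⟩
        simpa [hττ] using hl'
      · exact fun hl => ⟨τ l, hl, hττ l⟩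
    · simp [hM₁, hw]
  have hcard : ∀ w, #(M₁ w) = #(M w) := by
    intro w
    by_cases hw : w ∈ C <;> simp [hM₁, hw]
  have hX : ∀ l, l ≠ i → l ≠ j → #{w ∈ W | l ∈ M₁ w} = #{w ∈ W | l ∈ M w} := by
    intro l h1 h2
    congr 1
    ext w
    simp only [mem_filter, hmem, hτne l h1 h2]
    tauto
  have hXi : ({w ∈ W | i ∈ M₁ w} : Finset V) = {w ∈ ({w ∈ W | j ∈ M w} : Finset V) | w ∈ C} := by
    ext w
    simp only [mem_filter, hmem, hτi]
    have := hi0 w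
    tauto
  have hXj : ({w ∈ W | j ∈ M₁ w} : Finset V) = {w ∈ ({w ∈ W | j ∈ M w} : Finset V) | w ∉ C} := by
    ext w
    simp only [mem_filter, hmem, hτj]
    have := hi0 w
    tauto
  have hsum : #{w ∈ W | i ∈ M₁ w} + #{w ∈ W | j ∈ M₁ w} = #{w ∈ W | j ∈ M w} := by
    rw [hXi, hXj, card_filter_add_card_filter_not]
  have hpos : 1 ≤ #{w ∈ W | i ∈ M₁ w} := by
    rw [hXi]
    exact card_pos.2 ⟨x, by simp [hx, hxC]⟩
  have hle : #{w ∈ W | i ∈ M₁ w} ≤ 2 := by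
    have hx' : x ∈ ({w ∈ W | i ∈ M₁ w} : Finset V) := by rw [hXi]; simp [hx, hxC]
    have : #(({w ∈ W | i ∈ M₁ w} : Finset V).erase x) ≤ 1 := by
      rw [hXi, card_le_one]
      simp only [mem_erase, mem_filter]
      rintro y ⟨hyx, ⟨hyW, hyj⟩, hyC⟩ z ⟨hzx, ⟨hzW, hzj⟩, hzC⟩
      exact hC y hyC z hzC (hfix y hyW j hyj) (hfix z hzW j hzj) hyx hzx
    rw [card_erase_of_mem hx'] at this
    omega
  have hdec : ∑ l ∈ K, #{w ∈ W | l ∈ M₁ w} ^ 2 < s := by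
    rw [← h, ← add_sum_erase _ _ hiK, ← add_sum_erase K _ hiK,
      ← add_sum_erase (K.erase i) _ (mem_erase.2 ⟨hij.symm, hjK⟩),
      ← add_sum_erase (K.erase i) _ (mem_erase.2 ⟨hij.symm, hjK⟩), ← add_assoc, ← add_assoc]
    refine add_lt_add_of_lt_of_le ?_ (le_of_eq (sum_congr rfl fun l hl => ?_))
    · rw [← hsum]
      nlinarith
    · simp only [mem_erase] at hl
      rw [hX l hl.2.1 hl.1]
  obtain ⟨m', M', h1, h2, h3, h4, h5, h6⟩ := ih _ hdec m₁ M₁ (fun l y => by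
      by_cases h1 : l = i
      · subst h1
        by_cases hy : y ∈ C
        · simp [hm₁, hy, hτi, hCj y hy, hm j y]
        · have : m l y ∉ C := fun h => hy (by simpa [hm l y] using hCi _ h)
          simp [hm₁, hy, this, hm l y]
      by_cases h2 : l = j
      · subst h2
        by_cases hy : y ∈ C
        · simp [hm₁, hy, hτj, hCi y hy, hm i y]
        · have : m l y ∉ C := fun h => hy (by simpa [hm l y] using hCj _ h)
          simp [hm₁, hy, this, hm l y]
      simp [hm₁, hτne l h1 h2, hm l y])
    (fun w hw l hl => by
      rcases (hmem l w).1 hl with ⟨-, h⟩ | ⟨-, h⟩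
      · simpa [hττ] using hτK _ (hMK w hw h)
      · exact hMK w hw h)
    (fun w hw l hl => by
      rcases (hmem l w).1 hl with ⟨hC, h⟩ | ⟨hC, h⟩
      · simpa [hm₁, hC] using hfix w hw _ h
      · simpa [hm₁, hC] using hfix w hw _ h)
    (by simpa only [hcard, hcount] using hodd) (by simpa only [hcard, hcount] using hlt) rfl
  refine ⟨m', M', h1, h2, h3, fun w => (h4 w).trans (hcard w), ?_, h6⟩
  rintro y z ⟨l, hl, rfl⟩
  refine h5 _ _ ?_
  by_cases hy : y ∈ C
  · exact ⟨τ l, hτK l hl, by simp [hm₁, hy, hττ]⟩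
  · exact ⟨l, hl, by simp [hm₁, hy]⟩

open Function Finset Classical in
/-- If the colour lists `M w`, `w ∈ W`, of missing colours have size at least two, with one possible
exception of size at least one, then after recolouring there is a system of distinct
representatives consisting of missing colours. -/
lemma exists_recolouring_injOn {V κ : Type*} [Nonempty κ] (K : Finset κ) (W : Finset V)
    (m : κ → V → V) (M : V → Finset κ) (w₀ : V) (hm : ∀ l, Involutive (m l))
    (hMK : ∀ w ∈ W, M w ⊆ K) (hfix : ∀ w ∈ W, ∀ l ∈ M w, m l w = w)
    (htwo : ∀ w ∈ W, w ≠ w₀ → 2 ≤ #(M w)) (hone : ∀ w ∈ W, 1 ≤ #(M w)) (hWK : #W ≤ #K) :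
    ∃ (m' : κ → V → V) (f : V → κ), (∀ l, Involutive (m' l)) ∧ Set.InjOn f W ∧
      (∀ w ∈ W, f w ∈ K ∧ m' (f w) w = w) ∧
      ∀ y z, (∃ l ∈ K, m l y = z) → ∃ l ∈ K, m' l y = z := by
  induction h : #W generalizing K W m M w₀ with
  | zero =>
    rw [card_eq_zero] at h
    subst h
    exact ⟨m, Classical.arbitrary _, hm, by simp, by simp, fun _ _ h => h⟩
  | succ n ih =>
    obtain ⟨w₁, hw₁, hw₁'⟩ : ∃ w₁ ∈ W, ∀ w ∈ W, w ≠ w₁ → w ≠ w₀ := by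
      by_cases h0 : w₀ ∈ W
      · exact ⟨w₀, h0, fun _ _ h => h⟩
      · obtain ⟨w, hw⟩ := card_pos.1 (by omega : 0 < #W)
        exact ⟨w, hw, fun v hv _ hv' => h0 (hv' ▸ hv)⟩
    have hsub : ∀ w, ∃ N, w ∈ W → N ⊆ M w ∧ #N = if w = w₁ then 1 else 2 := by
      intro w
      by_cases hw : w ∈ W
      · obtain ⟨N, hN⟩ := exists_subset_card_eq (s := M w) (n := if w = w₁ then 1 else 2) (by
          split_ifs with h1
          · exact hone w hw
          · exact htwo w hw (hw₁' w hw h1))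
        exact ⟨N, fun _ => hN⟩
      · exact ⟨∅, fun h => absurd h hw⟩
    choose N hN using hsub
    have hsum : ∑ w ∈ W, #(N w) = 1 + 2 * n := by
      rw [sum_congr rfl fun w hw => (hN w hw).2, ← add_sum_erase W _ hw₁,
        sum_congr rfl fun w hw => if_neg (ne_of_mem_erase hw)]
      simp [card_erase_of_mem hw₁, h, mul_comm]
    obtain ⟨m₁, M₁, hm₁, hMK₁, hfix₁, hcard₁, hcov₁, i, hiK, hi⟩ :=
      exists_recolouring_card_eq_one K W m N hm (fun w hw => (hN w hw).1.trans (hMK w hw))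
        (fun w hw l hl => hfix w hw l ((hN w hw).1 hl)) (hsum ▸ ⟨n, by ring⟩) (by omega)
    obtain ⟨u, hu⟩ := card_eq_one.1 hi
    have huW : u ∈ W ∧ i ∈ M₁ u := by
      rw [← mem_filter (p := fun w => i ∈ M₁ w), hu, mem_singleton]
    have hiu : ∀ w ∈ W, w ≠ u → i ∉ M₁ w := fun w hw hwu hiw =>
      hwu (by rw [← mem_singleton, ← hu, mem_filter]; exact ⟨hw, hiw⟩)
    obtain ⟨m₂, f, hm₂, hf, hfK, hcov₂⟩ := ih (K.erase i) (W.erase u) m₁ M₁ w₁ hm₁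
      (fun w hw => by
        rw [mem_erase] at hw
        exact subset_erase.2 ⟨hMK₁ w hw.2, hiu w hw.2 hw.1⟩)
      (fun w hw => hfix₁ w (mem_of_mem_erase hw))
      (fun w hw hw' => by
        rw [hcard₁, (hN w (mem_of_mem_erase hw)).2, if_neg hw'])
      (fun w hw => by
        rw [hcard₁, (hN w (mem_of_mem_erase hw)).2]
        split_ifs <;> omega)
      (by rw [card_erase_of_mem hiK, card_erase_of_mem huW.1]; omega)
      (by rw [card_erase_of_mem huW.1]; omega)
    refine ⟨update m₂ i (m₁ i), update f u i, fun l => ?_, ?_, fun w hw => ?_, ?_⟩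
    · by_cases hl : l = i
      · subst hl; simpa using hm₁ l
      · simpa [hl] using hm₂ l
    · have hne : ∀ w ∈ W, w ≠ u → f w ≠ i := fun w hw hwu =>
        ne_of_mem_erase (hfK w (mem_erase.2 ⟨hwu, hw⟩)).1
      intro v hv w hw hvw
      by_cases h1 : v = u <;> by_cases h2 : w = u
      · rw [h1, h2]
      · subst h1
        simp only [update_self, update_of_ne h2] at hvw
        exact absurd hvw.symm (hne w hw h2)
      · subst h2
        simp only [update_self, update_of_ne h1] at hvw
        exact absurd hvw (hne v hv h1)
      · simp only [update_of_ne h1, update_of_ne h2] at hvw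
        exact hf (mem_coe.2 (mem_erase.2 ⟨h1, hv⟩)) (mem_coe.2 (mem_erase.2 ⟨h2, hw⟩)) hvw
    · by_cases h1 : w = u
      · subst h1
        simpa using ⟨hiK, hfix₁ w hw i huW.2⟩
      · obtain ⟨h3, h4⟩ := hfK w (mem_erase.2 ⟨h1, hw⟩)
        rw [mem_erase] at h3
        rw [update_of_ne h1, update_of_ne h3.1]
        exact ⟨h3.2, h4⟩
    · intro y z hyz
      obtain ⟨l, hl, hlyz⟩ := hcov₁ y z hyz
      by_cases hli : l = i
      · exact ⟨i, hiK, by simpa [hli] using hlyz⟩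
      · obtain ⟨l', hl', h'⟩ := hcov₂ y z ⟨l, mem_erase.2 ⟨hli, hl⟩, hlyz⟩
        rw [mem_erase] at hl'
        exact ⟨l', hl'.2, by rwa [update_of_ne hl'.1]⟩

open Function Finset Classical in
/-- **Vizing's theorem**: a finite simple graph with maximum degree at most `d` has a proper edge
colouring with `d + 1` colours. -/
theorem exists_edgeColouring {V : Type*} [Finite V] (H : SimpleGraph V) (d : ℕ)
    (hd : ∀ v, (H.neighborSet v).ncard ≤ d) :
    ∃ c : Sym2 V → Fin (d + 1), ∀ x y z, H.Adj x y → H.Adj x z → y ≠ z → c s(x, y) ≠ c s(x, z) := by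
  have key : ∀ S : Finset V, ∃ c : Sym2 V → Fin (d + 1), ∀ x ∈ S, ∀ y ∈ S, ∀ z ∈ S,
      H.Adj x y → H.Adj x z → c s(x, y) = c s(x, z) → y = z := by
    intro S
    induction S using Finset.induction_on with
    | empty => exact ⟨fun _ => 0, by simp⟩
    | insert v S hvS ih =>
    obtain ⟨c, hc⟩ := ih
    let P : Fin (d + 1) → V → V → Prop := fun l x y => x ∈ S ∧ y ∈ S ∧ H.Adj x y ∧ c s(x, y) = l
    have hP : ∀ l x y, P l x y → P l y x := fun l x y ⟨h1, h2, h3, h4⟩ =>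
      ⟨h2, h1, h3.symm, by rwa [Sym2.eq_swap]⟩
    have hPu : ∀ l x y z, P l x y → P l x z → y = z := fun l x y z ⟨h1, h2, h3, h4⟩ ⟨_, h5, h6, h7⟩ =>
      hc x h1 y h2 z h5 h3 h6 (h4.trans h7.symm)
    let m : Fin (d + 1) → V → V := fun l x => if h : ∃ y, P l x y then h.choose else x
    have hmP : ∀ l x y, P l x y → m l x = y := fun l x y h => by
      have h' : ∃ y, P l x y := ⟨y, h⟩
      simp only [m, dif_pos h']
      exact hPu l x _ _ h'.choose_spec h
    have hmn : ∀ l x, (¬ ∃ y, P l x y) → m l x = x := fun l x h => by simp only [m, dif_neg h]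
    have hm : ∀ l, Involutive (m l) := fun l x => by
      by_cases h : ∃ y, P l x y
      · obtain ⟨y, hy⟩ := h
        rw [hmP l x y hy, hmP l y x (hP l x y hy)]
      · rw [hmn l x h, hmn l x h]
    let W : Finset V := {w ∈ S | H.Adj v w}
    let M : V → Finset (Fin (d + 1)) := fun w => {l | ¬ ∃ y, P l w y}
    have hM : ∀ w ∈ W, 2 ≤ #(M w) := by
      intro w hw
      rw [mem_filter] at hw
      let D : Finset V := {y ∈ S | H.Adj w y}
      have hD : #D + 1 ≤ d := by
        refine le_trans ?_ (hd w)
        rw [← card_insert_of_notMem (s := D) (a := v) (by simp [D, hvS]), ← Set.ncard_coe_finset]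
        refine Set.ncard_le_ncard (fun y hy => ?_) (Set.toFinite _)
        rcases mem_insert.1 (mem_coe.1 hy) with rfl | hy
        · exact hw.2.symm
        · exact (mem_filter.1 hy).2
      have hcompl : #(M w)ᶜ ≤ #D := by
        refine (card_le_card (t := D.image fun y => c s(w, y)) fun l hl => ?_).trans card_image_le
        simp only [M, mem_compl, mem_filter, mem_univ, true_and, not_not] at hl
        obtain ⟨y, hy⟩ := hl
        exact mem_image.2 ⟨y, mem_filter.2 ⟨hy.2.1, hy.2.2.1⟩, hy.2.2.2⟩
      rw [card_compl, Fintype.card_fin] at hcompl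
      omega
    have hW : #W ≤ d := by
      refine le_trans ?_ (hd v)
      rw [← Set.ncard_coe_finset]
      exact Set.ncard_le_ncard (fun y hy => (mem_filter.1 hy).2) (Set.toFinite _)
    obtain ⟨m', f, hm', hf, hfK, hcov⟩ := exists_recolouring_injOn univ W m M v hm
      (fun w _ => subset_univ _) (fun w _ l hl => hmn l w (mem_filter.1 hl).2)
      (fun w hw _ => hM w hw) (fun w hw => one_le_two.trans (hM w hw))
      (by rw [card_univ, Fintype.card_fin]; omega)
    let R : Fin (d + 1) → V → V → Prop := fun l x y =>
      (x ∈ S ∧ y ∈ S ∧ m' l x = y) ∨ (x = v ∧ y ∈ W ∧ f y = l) ∨ (y = v ∧ x ∈ W ∧ f x = l)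
    have hRs : ∀ l x y, R l x y → R l y x := by
      rintro l x y (⟨h1, h2, rfl⟩ | h | h)
      · exact Or.inl ⟨h2, h1, hm' l x⟩
      · exact Or.inr (Or.inr h)
      · exact Or.inr (Or.inl h)
    have hWS : ∀ w ∈ W, w ∈ S := fun w hw => (mem_filter.1 hw).1
    have hRu : ∀ l x y z, x ≠ y → x ≠ z → R l x y → R l x z → y = z := by
      rintro l x y z hxy hxz (⟨h1, h2, h3⟩ | ⟨h1, h2, h3⟩ | ⟨h1, h2, h3⟩)
        (⟨k1, k2, k3⟩ | ⟨k1, k2, k3⟩ | ⟨k1, k2, k3⟩)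
      · exact h3.symm.trans k3
      · exact absurd (k1 ▸ h1) hvS
      · exact absurd (by rw [← h3, ← k3, (hfK x k2).2]) hxy
      · exact absurd (h1 ▸ k1) hvS
      · exact hf h2 k2 (h3.trans k3.symm)
      · exact absurd (h1 ▸ hWS _ k2) hvS
      · exact absurd (by rw [← k3, ← h3, (hfK x h2).2]) hxz
      · exact absurd (k1 ▸ hWS _ h2) hvS
      · exact h1.trans k1.symm
    have hRex : ∀ x ∈ insert v S, ∀ y ∈ insert v S, H.Adj x y → ∃ l, R l x y := by
      intro x hx y hy hxy
      rcases mem_insert.1 hx with rfl | hx' <;> rcases mem_insert.1 hy with rfl | hy'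
      · exact absurd hxy H.irrefl
      · exact ⟨f y, Or.inr (Or.inl ⟨rfl, mem_filter.2 ⟨hy', hxy⟩, rfl⟩)⟩
      · exact ⟨f x, Or.inr (Or.inr ⟨rfl, mem_filter.2 ⟨hx', hxy.symm⟩, rfl⟩)⟩
      · obtain ⟨l, -, hl⟩ := hcov x y ⟨c s(x, y), mem_univ _, hmP _ _ _ ⟨hx', hy', hxy, rfl⟩⟩
        exact ⟨l, Or.inl ⟨hx', hy', hl⟩⟩
    let Q : Sym2 V → Fin (d + 1) → Prop := fun e l => ∃ x y, e = s(x, y) ∧ R l x y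
    have hQ : ∀ l x y, Q s(x, y) l → R l x y := by
      rintro l x y ⟨x', y', he, hR⟩
      rcases Sym2.eq_iff.1 he with ⟨rfl, rfl⟩ | ⟨rfl, rfl⟩
      · exact hR
      · exact hRs _ _ _ hR
    let c' : Sym2 V → Fin (d + 1) := fun e => if h : ∃ l, Q e l then h.choose else 0
    have hc' : ∀ x ∈ insert v S, ∀ y ∈ insert v S, H.Adj x y → R (c' s(x, y)) x y := by
      intro x hx y hy hxy
      obtain ⟨l, hl⟩ := hRex x hx y hy hxy
      have h : ∃ l, Q s(x, y) l := ⟨l, x, y, rfl, hl⟩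
      simp only [c', dif_pos h]
      exact hQ _ _ _ h.choose_spec
    refine ⟨c', fun x hx y hy z hz hxy hxz he => ?_⟩
    exact hRu _ x y z hxy.ne hxz.ne (hc' x hx y hy hxy) (he ▸ hc' x hx z hz hxz)
  have := Fintype.ofFinite V
  obtain ⟨c, hc⟩ := key univ
  exact ⟨c, fun x y z hxy hxz hyz he =>
    hyz (hc x (mem_univ _) y (mem_univ _) z (mem_univ _) hxy hxz he)⟩

/-- A graph containing a closed walk of odd length contains an odd cycle. -/
lemma exists_isCycle_odd_of_odd_loop {V : Type*} {G : SimpleGraph V} {u : V} (w : G.Walk u u)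
    (hw : Odd w.length) : ∃ (v : V) (p : G.Walk v v), p.IsCycle ∧ Odd p.length := by
  induction h : w.length using Nat.strong_induction_on generalizing u w with
  | _ n ih =>
  subst h
  by_cases hc : w.IsCycle
  · exact ⟨u, w, hc, hw⟩
  have hne1 : w.length ≠ 1 := fun h1 => G.irrefl (w.adj_of_length_eq_one h1)
  have h3 : 3 ≤ w.length := by
    obtain ⟨r, hr⟩ := hw
    omega
  have hnn : ¬ w.Nil := by
    rw [← Walk.length_eq_zero_iff]
    omega
  rw [Walk.isCycle_iff_isPath_tail_and_le_length, ← Walk.IsPath.getVert_injOn_iff] at hc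
  have hinj : ¬ Set.InjOn w.tail.getVert {i | i ≤ w.tail.length} := fun h => hc ⟨h, h3⟩
  obtain ⟨i, j, hij, hj, he⟩ : ∃ i j, i < j ∧ j ≤ w.tail.length ∧
      w.tail.getVert i = w.tail.getVert j := by
    simp only [Set.InjOn, not_forall] at hinj
    obtain ⟨i, hi, j, hj, he, hij⟩ := hinj
    rcases lt_or_gt_of_ne hij with h | h
    · exact ⟨i, j, h, hj, he⟩
    · exact ⟨j, i, h, hi, he.symm⟩
  have hlen := Walk.length_tail_add_one hnn
  rw [Walk.getVert_tail, Walk.getVert_tail] at he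
  let w₁ := (w.take (i + 1)).append ((w.drop (j + 1)).copy he.symm rfl)
  let w₂ := ((w.drop (i + 1)).take (j - i)).copy rfl (by
    rw [Walk.drop_getVert, he]; congr 1; omega : _ = w.getVert (i + 1))
  have hl₁ : w₁.length = i + 1 + (w.length - (j + 1)) := by
    simp only [w₁, Walk.length_append, Walk.length_copy, Walk.take_length, Walk.drop_length]
    omega
  have hl₂ : w₂.length = j - i := by
    simp only [w₂, Walk.length_copy, Walk.take_length, Walk.drop_length]
    omega
  by_cases hodd : Odd w₁.length
  · exact ih _ (by omega) w₁ hodd rfl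
  · refine ih _ (by omega) w₂ ?_ rfl
    rw [Nat.not_odd_iff_even] at hodd
    obtain ⟨r, hr⟩ := hodd
    obtain ⟨t, ht⟩ := hw
    exact ⟨t - r, by omega⟩

lemma colorable_chi {V : Type*} [Finite V] (G : SimpleGraph V) : G.Colorable (chi G) := by
  have := Fintype.ofFinite V
  exact Nat.sInf_mem (s := {n | G.Colorable n}) ⟨_, G.colorable_of_fintype⟩

lemma chi_le_of_colorable {V : Type*} {G : SimpleGraph V} {n : ℕ} (h : G.Colorable n) :
    chi G ≤ n :=
  Nat.sInf_le h

lemma cliqueNum_le_chi {V : Type*} [Finite V] (G : SimpleGraph V) : G.cliqueNum ≤ chi G := by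
  obtain ⟨s, hs⟩ := G.exists_isNClique_cliqueNum
  exact hs.card_eq ▸ hs.isClique.card_le_of_colorable (colorable_chi G)

lemma isPerfect_of_subsingleton {V : Type*} [Finite V] [Subsingleton V] (G : SimpleGraph V) :
    IsPerfect G := by
  intro s
  refine le_antisymm (chi_le_of_colorable ?_) (cliqueNum_le_chi _)
  rcases isEmpty_or_nonempty s with h | ⟨⟨x⟩⟩
  · exact Colorable.of_isEmpty _
  · have h1 : 1 ≤ (G.induce s).cliqueNum := by
      have : (G.induce s).IsClique (({x} : Finset s) : Set s) := by simp
      simpa using this.card_le_cliqueNum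
    exact Colorable.mono h1 ⟨Coloring.mk (fun _ => 0) fun {a b} hab =>
      (hab.ne (Subsingleton.elim a b)).elim⟩

/-- Line graphs are nice. -/
theorem isNice_lineGraph {V : Type*} [Finite V] (H : SimpleGraph V) : IsNice H.lineGraph := by
  classical
  intro s
  have hle := cliqueNum_le_chi (H.lineGraph.induce s)
  set d := (H.lineGraph.induce s).cliqueNum with hd
  let F : SimpleGraph V := fromEdgeSet (Subtype.val '' s)
  have hF : ∀ x y, F.Adj x y → ∃ h : s(x, y) ∈ H.edgeSet, (⟨s(x, y), h⟩ : H.edgeSet) ∈ s := by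
    intro x y hxy
    obtain ⟨⟨⟨e, he⟩, hes, rfl⟩, -⟩ := (fromEdgeSet_adj _).1 hxy
    exact ⟨he, hes⟩
  have hdeg : ∀ v, (F.neighborSet v).ncard ≤ d := by
    intro v
    let g : F.neighborSet v → s := fun y => ⟨⟨s(v, y.1), (hF v y.1 y.2).1⟩, (hF v y.1 y.2).2⟩
    have hg : Function.Injective g := by
      intro y z hyz
      have : s(v, y.1) = s(v, z.1) := congrArg (fun e : s => e.1.1) hyz
      exact Subtype.ext (Sym2.congr_right.1 this)
    have := Fintype.ofFinite (F.neighborSet v)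
    have hclique : (H.lineGraph.induce s).IsClique
        ((Finset.univ.image g : Finset s) : Set s) := by
      intro e he f hf hef
      simp only [Finset.coe_image, Finset.coe_univ, Set.image_univ, Set.mem_range] at he hf
      obtain ⟨y, rfl⟩ := he
      obtain ⟨z, rfl⟩ := hf
      rw [comap_adj, lineGraph_adj_iff_exists]
      exact ⟨fun h => hef (Subtype.ext h), v, Sym2.mem_mk_left _ _, Sym2.mem_mk_left _ _⟩
    have := hclique.card_le_cliqueNum
    rwa [Finset.card_image_of_injective _ hg, Finset.card_univ, ← Nat.card_eq_fintype_card,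
      Nat.card_coe_set_eq] at this
  obtain ⟨c, hc⟩ := exists_edgeColouring F d hdeg
  have hcol : (H.lineGraph.induce s).Colorable (d + 1) := by
    refine ⟨Coloring.mk (fun e => c e.1.1) ?_⟩
    rintro ⟨⟨e, he⟩, hes⟩ ⟨⟨f, hf⟩, hfs⟩ hadj
    rw [comap_adj, lineGraph_adj_iff_exists] at hadj
    obtain ⟨hne, v, hve, hvf⟩ := hadj
    obtain ⟨y, rfl⟩ := Sym2.mem_iff_exists.1 hve
    obtain ⟨z, rfl⟩ := Sym2.mem_iff_exists.1 hvf
    have hF' : ∀ y (hy : s(v, y) ∈ H.edgeSet), (⟨s(v, y), hy⟩ : H.edgeSet) ∈ s → F.Adj v y :=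
      fun y hy hys => (fromEdgeSet_adj _).2 ⟨⟨_, hys, rfl⟩, H.ne_of_adj hy⟩
    refine hc v y z (hF' y he hes) (hF' z hf hfs) ?_
    rintro rfl
    exact hne rfl
  have := chi_le_of_colorable hcol
  omega

lemma Sym2.exists_mem_or_triangle {V : Type*} {e₁ e₂ e₃ : Sym2 V} (h₁₂ : ∃ v, v ∈ e₁ ∧ v ∈ e₂)
    (h₁₃ : ∃ v, v ∈ e₁ ∧ v ∈ e₃) (h₂₃ : ∃ v, v ∈ e₂ ∧ v ∈ e₃) :
    (∃ v, v ∈ e₁ ∧ v ∈ e₂ ∧ v ∈ e₃) ∨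
      ∃ x y z, e₁ = s(x, y) ∧ e₂ = s(x, z) ∧ e₃ = s(y, z) := by
  obtain ⟨x, hx₁, hx₂⟩ := h₁₂
  obtain ⟨y, hy₁, hy₃⟩ := h₁₃
  obtain ⟨z, hz₂, hz₃⟩ := h₂₃
  by_cases hxy : x = y
  · exact Or.inl ⟨x, hx₁, hx₂, hxy ▸ hy₃⟩
  by_cases hxz : x = z
  · exact Or.inl ⟨x, hx₁, hx₂, hxz ▸ hz₃⟩
  by_cases hyz : y = z
  · exact Or.inl ⟨y, hy₁, hyz ▸ hz₂, hy₃⟩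
  exact Or.inr ⟨x, y, z, (Sym2.mem_and_mem_iff hxy).1 ⟨hx₁, hy₁⟩,
    (Sym2.mem_and_mem_iff hxz).1 ⟨hx₂, hz₂⟩, (Sym2.mem_and_mem_iff hyz).1 ⟨hy₃, hz₃⟩⟩

/-- If `H` is triangle-free and a set of edges of `H` is perfect in the line graph of `H`, then
these edges form a bipartite graph. -/
lemma colorable_two_of_isPerfect_lineGraph {V : Type*} [Finite V] {H : SimpleGraph V}
    (hH : H.CliqueFree 3) (B : Set H.edgeSet) (hB : IsPerfect (H.lineGraph.induce B)) :
    (fromEdgeSet (Subtype.val '' B)).Colorable 2 := by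
  classical
  rw [two_colorable_iff_forall_loop_even]
  by_contra! hcon
  obtain ⟨u, w, hw⟩ := hcon
  obtain ⟨v, p, hp, hodd⟩ := exists_isCycle_odd_of_odd_loop w (Nat.not_even_iff_odd.1 hw)
  let A : Set B := {e | e.1.1 ∈ p.edges}
  have hlen := hp.three_le_length
  have hpB : ∀ e ∈ p.edges, ∃ h : e ∈ H.edgeSet, (⟨e, h⟩ : H.edgeSet) ∈ B := by
    intro e he
    have := p.edges_subset_edgeSet he
    rw [edgeSet_fromEdgeSet] at this
    obtain ⟨⟨⟨e, heH⟩, heB, rfl⟩, -⟩ := this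
    exact ⟨heH, heB⟩
  have hclique : ((H.lineGraph.induce B).induce A).cliqueNum ≤ 2 := by
    obtain ⟨s, hs⟩ := ((H.lineGraph.induce B).induce A).exists_isNClique_cliqueNum
    rw [← hs.card_eq]
    by_contra! hcard
    obtain ⟨e₁, h₁, e₂, h₂, e₃, h₃, h₁₂, h₁₃, h₂₃⟩ := Finset.two_lt_card.1 hcard
    have hadj : ∀ e ∈ s, ∀ f ∈ s, e ≠ f → ∃ v, v ∈ e.1.1.1 ∧ v ∈ f.1.1.1 := by
      intro e he f hf hef
      have := hs.isClique he hf hef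
      rw [comap_adj, comap_adj, lineGraph_adj_iff_exists] at this
      exact this.2
    have hval : ∀ e f : A, e ≠ f → e.1.1.1 ≠ f.1.1.1 := fun e f hef h =>
      hef (Subtype.ext (Subtype.ext (Subtype.ext h)))
    rcases Sym2.exists_mem_or_triangle (hadj _ h₁ _ h₂ h₁₂) (hadj _ h₁ _ h₃ h₁₃)
      (hadj _ h₂ _ h₃ h₂₃) with ⟨x, hx₁, hx₂, hx₃⟩ | ⟨x, y, z, hxy, hxz, hyz⟩
    · obtain ⟨y₁, hy₁⟩ := Sym2.mem_iff_exists.1 hx₁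
      obtain ⟨y₂, hy₂⟩ := Sym2.mem_iff_exists.1 hx₂
      obtain ⟨y₃, hy₃⟩ := Sym2.mem_iff_exists.1 hx₃
      have he₁ : e₁.1.1.1 ∈ p.edges := e₁.2
      have hx : x ∈ p.support := p.fst_mem_support_of_mem_edges (hy₁ ▸ he₁)
      have hN : ∀ (e : A) y, e.1.1.1 = s(x, y) → y ∈ p.toSubgraph.neighborSet x := by
        intro e y hy
        rw [Subgraph.mem_neighborSet, Walk.adj_toSubgraph_iff_mem_edges, ← hy]
        exact e.2
      have hle : ({y₁, y₂, y₃} : Set V).ncard ≤ (p.toSubgraph.neighborSet x).ncard := by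
        refine Set.ncard_le_ncard ?_ (Set.toFinite _)
        rintro y (rfl | rfl | rfl)
        exacts [hN e₁ _ hy₁, hN e₂ _ hy₂, hN e₃ _ hy₃]
      rw [hp.ncard_neighborSet_toSubgraph_eq_two hx, Set.ncard_eq_three.2 ⟨y₁, y₂, y₃,
        fun h => hval _ _ h₁₂ (by rw [hy₁, hy₂, h]), fun h => hval _ _ h₁₃ (by rw [hy₁, hy₃, h]),
        fun h => hval _ _ h₂₃ (by rw [hy₂, hy₃, h]), rfl⟩] at hle
      omega
    · refine hH {x, y, z} (is3Clique_triple_iff.2 ⟨?_, ?_, ?_⟩)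
      · rw [← mem_edgeSet, ← hxy]; exact e₁.1.1.2
      · rw [← mem_edgeSet, ← hxz]; exact e₂.1.1.2
      · rw [← mem_edgeSet, ← hyz]; exact e₃.1.1.2
  obtain ⟨c⟩ := (colorable_chi ((H.lineGraph.induce B).induce A)).mono ((hB A).trans_le hclique)
  have hmem : ∀ i, i < p.length → s(p.getVert i, p.getVert (i + 1)) ∈ p.edges := fun i hi => by
    rw [← Walk.adj_toSubgraph_iff_mem_edges]
    exact p.toSubgraph_adj_getVert hi
  let e : ∀ i, i < p.length → A := fun i hi =>
    ⟨⟨⟨s(p.getVert i, p.getVert (i + 1)), (hpB _ (hmem i hi)).1⟩, (hpB _ (hmem i hi)).2⟩, hmem i hi⟩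
  have hne : ∀ x y z (hxy : s(x, y) ∈ p.edges) (hxz : s(x, z) ∈ p.edges), y ≠ z →
      c ⟨⟨⟨s(x, y), (hpB _ hxy).1⟩, (hpB _ hxy).2⟩, hxy⟩ ≠
        c ⟨⟨⟨s(x, z), (hpB _ hxz).1⟩, (hpB _ hxz).2⟩, hxz⟩ := by
    intro x y z hxy hxz hyz
    apply c.valid
    rw [comap_adj, comap_adj, lineGraph_adj_iff_exists]
    exact ⟨fun h => hyz (Sym2.congr_right.1 (congrArg Subtype.val h)), x, Sym2.mem_mk_left _ _,
      Sym2.mem_mk_left _ _⟩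
  have hswap : ∀ i hi, ∃ h, e i hi =
      ⟨⟨⟨s(p.getVert (i + 1), p.getVert i), (hpB _ h).1⟩, (hpB _ h).2⟩, h⟩ := fun i hi =>
    ⟨Sym2.eq_swap ▸ hmem i hi, Subtype.ext (Subtype.ext (Subtype.ext Sym2.eq_swap))⟩
  have hstep : ∀ i (hi : i + 1 < p.length), c (e i (by omega)) ≠ c (e (i + 1) hi) := by
    intro i hi
    obtain ⟨h, he⟩ := hswap i (by omega)
    rw [he]
    refine hne _ _ _ h (hmem _ hi) ?_
    have := hp.getVert_sub_one_ne_getVert_add_one (i := i + 1) (by omega)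
    simpa using this
  have hlast : c (e (p.length - 1) (by omega)) ≠ c (e 0 (by omega)) := by
    have hz : p.getVert (p.length - 1 + 1) = p.getVert 0 := by
      rw [Nat.sub_add_cancel (by omega), Walk.getVert_length, Walk.getVert_zero]
    obtain ⟨h, he⟩ := hswap (p.length - 1) (by omega)
    rw [he]
    simp only [hz]
    refine hne _ _ _ (hz ▸ h) (hmem 0 (by omega)) ?_
    exact hp.snd_ne_penultimate.symm
  have hfin : ∀ a b o : Fin 2, a ≠ b → (b = o ↔ ¬ a = o) := by decide
  have hpar : ∀ i (hi : i < p.length), c (e i hi) = c (e 0 (by omega)) ↔ Even i := by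
    intro i
    induction i with
    | zero => simp
    | succ i ih =>
      intro hi
      have h1 := ih (by omega)
      have h2 := hstep i hi
      rw [Nat.even_add_one, ← h1]
      exact hfin _ _ _ h2
  refine hlast ((hpar _ (by omega)).2 ?_)
  obtain ⟨r, hr⟩ := hodd
  exact ⟨r, by omega⟩

/-- The shift graph: `(a, b)` and `(b, c)` are adjacent for `a < b < c`. -/
def shiftGraph (N : ℕ) : SimpleGraph (Fin N × Fin N) where
  Adj p q := p.1 < p.2 ∧ q.1 < q.2 ∧ (p.2 = q.1 ∨ q.2 = p.1)
  symm.symm _ _ h := ⟨h.2.1, h.1, h.2.2.symm⟩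
  loopless.irrefl p h := by
    rcases h with ⟨h1, -, h | h⟩ <;> exact h1.ne h.symm

lemma shiftGraph_cliqueFree (N : ℕ) : (shiftGraph N).CliqueFree 3 := by
  intro s hs
  obtain ⟨a, b, c, hab, hac, hbc, -⟩ := is3Clique_iff.1 hs
  simp only [shiftGraph] at hab hac hbc
  omega

lemma le_two_pow_of_shiftGraph_colorable {N n : ℕ} (h : (shiftGraph N).Colorable n) :
    N ≤ 2 ^ n := by
  obtain ⟨c⟩ := h
  let S : Fin N → Set (Fin n) := fun i => {l | ∃ j, i < j ∧ c (i, j) = l}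
  have hlt : ∀ i j, i < j → S i ≠ S j := by
    intro i j hij hS
    have hmem : c (i, j) ∈ S j := hS ▸ ⟨j, hij, rfl⟩
    obtain ⟨k, hjk, hk⟩ := hmem
    exact c.valid (v := (i, j)) (w := (j, k)) ⟨hij, hjk, Or.inl rfl⟩ hk.symm
  have hS : Function.Injective S := by
    intro i j hij
    by_contra hne
    rcases lt_or_gt_of_ne hne with h | h
    · exact hlt i j h hij
    · exact hlt j i h hij.symm
  simpa using Fintype.card_le_of_injective S hS

/-- If the edges of a triangle-free graph are partitioned into `k` sets that are perfect in the
line graph, then the graph is `2 ^ k`-colorable. -/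
lemma colorable_two_pow_of_isPerfect_lineGraph {V : Type*} [Finite V] {H : SimpleGraph V}
    (hH : H.CliqueFree 3) {k : ℕ} (f : H.edgeSet → Fin k)
    (hf : ∀ i, IsPerfect (H.lineGraph.induce (f ⁻¹' {i}))) : H.Colorable (2 ^ k) := by
  let c : ∀ i, (fromEdgeSet (Subtype.val '' (f ⁻¹' {i}))).Coloring (Fin 2) := fun i =>
    (colorable_two_of_isPerfect_lineGraph hH _ (hf i)).some
  have C : H.Coloring (Fin k → Fin 2) := Coloring.mk (fun v i => c i v) fun {x y} hxy heq =>
    (c (f ⟨s(x, y), hxy⟩)).valid ((fromEdgeSet_adj _).2 ⟨⟨⟨s(x, y), hxy⟩, rfl, rfl⟩, hxy.ne⟩)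
      (congrFun heq _)
  simpa using C.colorable

lemma exists_isPerfect_partition {V : Type*} [Finite V] (G : SimpleGraph V) :
    ∃ f : V → Fin (chiP G), ∀ i, IsPerfect (G.induce (f ⁻¹' {i})) := by
  have := Fintype.ofFinite V
  refine Nat.sInf_mem (s := {k | ∃ f : V → Fin k, ∀ i, IsPerfect (G.induce (f ⁻¹' {i}))})
    ⟨_, Fintype.equivFin V, fun i => ?_⟩
  have : Subsingleton ((Fintype.equivFin V) ⁻¹' {i}) := by
    rw [Set.subsingleton_coe]
    exact Set.subsingleton_singleton.preimage (Fintype.equivFin V).injective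
  exact isPerfect_of_subsingleton _

/-- Nice graphs have unbounded perfect chromatic number. -/
theorem stmt_5 (k : ℕ) :
    ∃ (V : Type) (_ : Fintype V) (G : SimpleGraph V), IsNice G ∧ k < chiP G := by
  let H := shiftGraph (2 ^ 2 ^ k + 1)
  refine ⟨H.edgeSet, Fintype.ofFinite _, H.lineGraph, isNice_lineGraph H, ?_⟩
  by_contra! hle
  obtain ⟨f, hf⟩ := exists_isPerfect_partition H.lineGraph
  have h := le_two_pow_of_shiftGraph_colorable
    ((colorable_two_pow_of_isPerfect_lineGraph (shiftGraph_cliqueFree _) f hf).mono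
      (Nat.pow_le_pow_right two_pos hle))
  omega
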